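/- arXiv:1809.07584 — 2 statements merged into one kernel-verified Lean document; each statement's English description precedes it below -/
import Mathlib

section
/- Let m ≥ 3 and j ≥ 1 be integers, and let H := {0, 1, …, m−2} ∪ {m}. Then the j-fold sumset of H equals {0, 1, …, jm−2} ∪ {jm}; that is, jH consists of jm together with every nonnegative integer less than jm − 1, and jm − 1 ∉ jH. -/
open Filter Pointwise

/-- Counting function: `X(n) = |X ∩ [1, n]|`. -/
noncomputable def countUpTo (X : Set ℕ) (n : ℕ) : ℕ := (X ∩ Set.Icc 1 n).ncard

/-- The asymptotic density of `X` exists and equals `α`. -/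
def HasDensity (X : Set ℕ) (α : ℝ) : Prop :=
  Tendsto (fun n : ℕ => (countUpTo X n : ℝ) / n) atTop (nhds α)

/-- Lower asymptotic density. -/
noncomputable def lowerDensity (X : Set ℕ) : ℝ :=
  liminf (fun n : ℕ => (countUpTo X n : ℝ) / n) atTop

/-- Upper asymptotic density. -/
noncomputable def upperDensity (X : Set ℕ) : ℝ :=
  limsup (fun n : ℕ => (countUpTo X n : ℝ) / n) atTop

/-- The `j`-fold sumset `jA := {x₁ + ⋯ + x_j : xᵢ ∈ A}`. -/
def foldSum (j : ℕ) (A : Set ℕ) : Set ℕ :=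
  {x | ∃ f : Fin j → ℕ, (∀ i, f i ∈ A) ∧ x = ∑ i, f i}

theorem foldSum_succ_iff (j : ℕ) (A : Set ℕ) (x : ℕ) :
    x ∈ foldSum (j + 1) A ↔ ∃ a ∈ A, ∃ y ∈ foldSum j A, x = a + y := by
  constructor
  · rintro ⟨f, hf, rfl⟩
    exact ⟨f 0, hf 0, ∑ i : Fin j, f i.succ, ⟨fun i => f i.succ, fun i => hf _, rfl⟩,
      Fin.sum_univ_succ f⟩
  · rintro ⟨a, ha, y, ⟨f, hf, rfl⟩, rfl⟩
    refine ⟨Fin.cons a f, ?_, ?_⟩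
    · intro i
      refine Fin.cases ?_ ?_ i
      · simpa using ha
      · intro k
        simpa using hf k
    · simp [Fin.sum_univ_succ]

theorem foldSum_char (m : ℕ) (hm : 3 ≤ m) (k : ℕ) : ∀ x : ℕ,
    x ∈ foldSum (k + 1) ({h : ℕ | h ≤ m - 2} ∪ {m} : Set ℕ) ↔
      x + 2 ≤ (k + 1) * m ∨ x = (k + 1) * m := by
  induction k with
  | zero =>
    intro x
    rw [foldSum_succ_iff]
    have h0 : ∀ y, y ∈ foldSum 0 ({h : ℕ | h ≤ m - 2} ∪ {m} : Set ℕ) ↔ y = 0 := by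
      intro y
      simp [foldSum]
    simp only [h0, Set.mem_union, Set.mem_setOf_eq, Set.mem_singleton_iff]
    constructor
    · rintro ⟨a, ha, y, rfl, rfl⟩
      omega
    · intro h
      exact ⟨x, by omega, 0, rfl, rfl⟩
  | succ k ih =>
    intro x
    rw [foldSum_succ_iff]
    simp only [ih, Set.mem_union, Set.mem_setOf_eq, Set.mem_singleton_iff]
    have e : (k + 1 + 1) * m = (k + 1) * m + m := by ring
    have hN : m ≤ (k + 1) * m := Nat.le_mul_of_pos_left m (Nat.succ_pos k)
    rw [e]
    generalize (k + 1) * m = N at *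
    constructor
    · rintro ⟨a, ha, y, hy, rfl⟩
      omega
    · intro h
      by_cases h1 : x ≤ m - 2
      · exact ⟨x, Or.inl h1, 0, by omega, rfl⟩
      · by_cases h2 : x = m - 1
        · exact ⟨1, by omega, m - 2, by omega, by omega⟩
        · exact ⟨m, Or.inr rfl, x - m, by omega, by omega⟩

theorem stmt9 (m j : ℕ) (hm : 3 ≤ m) (hj : 1 ≤ j) :
    foldSum j ({h : ℕ | h ≤ m - 2} ∪ {m} : Set ℕ)
        = ({x : ℕ | x ≤ j * m - 2} ∪ {j * m} : Set ℕ) ∧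
    j * m - 1 ∉ foldSum j ({h : ℕ | h ≤ m - 2} ∪ {m} : Set ℕ) := by
  obtain ⟨k, rfl⟩ : ∃ k, j = k + 1 := ⟨j - 1, by omega⟩
  have hN : m ≤ (k + 1) * m := Nat.le_mul_of_pos_left m (Nat.succ_pos k)
  constructor
  · ext x
    rw [foldSum_char m hm k x]
    simp only [Set.mem_union, Set.mem_setOf_eq, Set.mem_singleton_iff]
    omega
  · rw [foldSum_char m hm k]
    omega
end

section
/- Let α be an irrational real number with 0 < α < 1, let θ := 1/α, let k ≥ 2 be an integer, and define A := {⌊nθ⌋ : n ∈ ℕ₊, {nθ} < 1/k}. Then for every integer j with 1 ≤ j ≤ k, the asymptotic density of the j-fold sumset jA exists and equals jα/k. -/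
open Filter Pointwise

lemma fract_dense {θ : ℝ} (hθ : Irrational θ) {a b : ℝ} (ha : 0 ≤ a) (hab : a < b) (hb : b ≤ 1) :
    ∃ n : ℕ, 0 < n ∧ a < Int.fract (n * θ) ∧ Int.fract (n * θ) < b := by
  have h1 : DenseRange (· • (θ : AddCircle (1:ℝ)) : ℤ → AddCircle (1:ℝ)) := by
    rw [AddCircle.denseRange_zsmul_coe_iff]; simpa using hθ
  rw [denseRange_zsmul_iff_nsmul] at h1
  have ho : IsOpen ((QuotientAddGroup.mk : ℝ → AddCircle (1:ℝ)) '' Set.Ioo a b) :=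
    QuotientAddGroup.isOpenMap_coe _ isOpen_Ioo
  obtain ⟨n, x, hx, hxn⟩ := h1.exists_mem_open ho ((Set.nonempty_Ioo.2 hab).image _)
  have e : ((n * θ - x : ℝ) : AddCircle (1:ℝ)) = 0 := by
    have h2 : ((n * θ : ℝ) : AddCircle (1:ℝ)) = n • (θ : AddCircle (1:ℝ)) := by
      rw [← nsmul_eq_mul]; rfl
    rw [AddCircle.coe_sub, h2, sub_eq_zero]; exact hxn.symm
  rw [AddCircle.coe_eq_zero_iff] at e
  obtain ⟨z, hz⟩ := e
  have hf : Int.fract (n * θ) = x := by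
    rw [Int.fract_eq_iff]
    refine ⟨ha.trans hx.1.le, hx.2.trans_le hb, z, ?_⟩
    simpa using hz.symm
  refine ⟨n, ?_, hf ▸ hx.1, hf ▸ hx.2⟩
  rcases Nat.eq_zero_or_pos n with h | h
  · subst h; simp at hf; linarith [hx.1]
  · exact h

open Classical in
noncomputable def DD (θ t : ℝ) (M : ℕ) : ℕ :=
  ((Finset.range M).filter (fun n : ℕ => Int.fract (n * θ) < t)).card

lemma DD_mono (θ : ℝ) {s t : ℝ} (h : s ≤ t) (M : ℕ) : DD θ s M ≤ DD θ t M := by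
  classical
  unfold DD
  apply Finset.card_le_card
  intro n hn
  simp only [Finset.mem_filter] at hn ⊢
  exact ⟨hn.1, hn.2.trans_le h⟩

lemma DD_le (θ t : ℝ) (M : ℕ) : DD θ t M ≤ M := by
  classical
  unfold DD
  exact (Finset.card_filter_le _ _).trans (by simp)

lemma DD_one (θ : ℝ) (M : ℕ) : DD θ 1 M = M := by
  classical
  unfold DD
  rw [Finset.filter_true_of_mem]
  · simp
  · intro x _; exact Int.fract_lt_one _

open Classical in
lemma DD_sub (θ : ℝ) {s t : ℝ} (h : s ≤ t) (M : ℕ) :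
    DD θ t M = DD θ s M + ((Finset.range M).filter
      (fun n : ℕ => s ≤ Int.fract (n * θ) ∧ Int.fract (n * θ) < t)).card := by
  unfold DD
  rw [← Finset.card_union_of_disjoint]
  · congr 1; ext n
    simp only [Finset.mem_filter, Finset.mem_union]
    constructor
    · rintro ⟨h1, h2⟩
      by_cases h3 : Int.fract (n * θ) < s
      · exact Or.inl ⟨h1, h3⟩
      · exact Or.inr ⟨h1, not_lt.1 h3, h2⟩
    · rintro (⟨h1, h2⟩ | ⟨h1, h2, h3⟩)
      · exact ⟨h1, h2.trans_le h⟩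
      · exact ⟨h1, h3⟩
  · rw [Finset.disjoint_left]
    intro n hn hn'
    simp only [Finset.mem_filter] at hn hn'
    linarith [hn.2, hn'.2.1]

lemma DD_add (θ : ℝ) (m : ℕ) {u : ℝ} (hu : 0 ≤ u) (hu1 : Int.fract (m * θ) + u ≤ 1) (M : ℕ) :
    DD θ (Int.fract (m * θ) + u) M ≤ DD θ (Int.fract (m * θ)) M + DD θ u M + m ∧
    DD θ (Int.fract (m * θ)) M + DD θ u M ≤ DD θ (Int.fract (m * θ) + u) M + m := by
  classical
  have hδ := Int.fract_nonneg (m * θ)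
  set δ := Int.fract (m * θ) with hd
  have hm : m * θ = ⌊m * θ⌋ + δ := (Int.floor_add_fract _).symm
  rw [DD_sub θ (show δ ≤ δ + u by linarith) M]
  constructor
  · rw [add_assoc]
    apply Nat.add_le_add_left
    calc _ ≤ (((Finset.range M).filter (fun n : ℕ => Int.fract (n * θ) < u)).image (· + m)
            ∪ Finset.range m).card := by
          apply Finset.card_le_card
          intro n hn
          simp only [Finset.mem_filter, Finset.mem_union, Finset.mem_range, Finset.mem_image] at hn ⊢
          by_cases h : n < m
          · exact Or.inr h
          · left
            obtain ⟨p, rfl⟩ := Nat.exists_eq_add_of_le' (not_lt.1 h)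
            refine ⟨p, ⟨by omega, ?_⟩, rfl⟩
            have : Int.fract (p * θ) = Int.fract ((p + m : ℕ) * θ) - δ := by
              rw [Int.fract_eq_iff]
              refine ⟨by linarith [hn.2.1], by linarith [Int.fract_lt_one (((p+m:ℕ):ℝ) * θ)],
                ⌊((p+m:ℕ):ℝ) * θ⌋ - ⌊m * θ⌋, ?_⟩
              have := Int.floor_add_fract (((p+m:ℕ):ℝ) * θ)
              push_cast at this ⊢
              linarith
            linarith [hn.2.2]
      _ ≤ _ := by
          refine (Finset.card_union_le _ _).trans ?_
          rw [Finset.card_range]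
          exact Nat.add_le_add_right Finset.card_image_le _
  · rw [add_assoc]
    apply Nat.add_le_add_left
    calc DD θ u M = (((Finset.range M).filter (fun n : ℕ => Int.fract (n * θ) < u)).image (· + m)).card := by
          rw [Finset.card_image_of_injective _ (add_left_injective m)]; rfl
      _ ≤ ((Finset.range M).filter
      (fun n : ℕ => δ ≤ Int.fract (n * θ) ∧ Int.fract (n * θ) < δ + u) ∪ Finset.Ico M (M + m)).card := by
          apply Finset.card_le_card
          intro n hn
          simp only [Finset.mem_filter, Finset.mem_union, Finset.mem_range, Finset.mem_image, Finset.mem_Ico] at hn ⊢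
          obtain ⟨p, ⟨hp, hpu⟩, rfl⟩ := hn
          by_cases h : p + m < M
          · left
            have : Int.fract ((p + m : ℕ) * θ) = Int.fract (p * θ) + δ := by
              rw [Int.fract_eq_iff]
              refine ⟨by linarith [Int.fract_nonneg ((p:ℝ) * θ)], by linarith,
                ⌊(p:ℝ) * θ⌋ + ⌊m * θ⌋, ?_⟩
              have := Int.floor_add_fract ((p:ℝ) * θ)
              push_cast at this ⊢
              linarith
            rw [this]
            exact ⟨h, by linarith [Int.fract_nonneg ((p:ℝ) * θ)], by linarith⟩
          · right; omega
      _ ≤ _ := by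
          refine (Finset.card_union_le _ _).trans ?_
          simp

lemma squeeze_lim {f t : ℝ}
    (h : ∀ ε : ℝ, 0 < ε → ε < 1 → ∃ δ, 0 < δ ∧ δ < ε ∧ f * (1 - δ) ≤ t + δ ∧ t - δ ≤ f * (1 + δ))
    (hf0 : 0 ≤ f) (hf1 : f ≤ 1) : f = t := by
  apply le_antisymm
  · apply le_of_forall_pos_le_add
    intro ε hε
    obtain ⟨δ, h1, h2, h3, h4⟩ := h (min (ε/2) (1/2)) (by positivity) (by
      exact (min_le_right _ _).trans_lt (by norm_num))
    have := h2.trans_le (min_le_left _ _)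
    nlinarith
  · apply le_of_forall_pos_le_add
    intro ε hε
    obtain ⟨δ, h1, h2, h3, h4⟩ := h (min (ε/2) (1/2)) (by positivity) (by
      exact (min_le_right _ _).trans_lt (by norm_num))
    have := h2.trans_le (min_le_left _ _)
    nlinarith

lemma dens {θ : ℝ} (hθ : Irrational θ) {t : ℝ} (ht : 0 ≤ t) (ht1 : t ≤ 1) :
    Tendsto (fun M : ℕ => (DD θ t M : ℝ) / M) atTop (nhds t) := by
  rw [tendsto_iff_ultrafilter]
  intro g hg
  have hex : ∀ s : ℝ, ∃ y ∈ Set.Icc (0:ℝ) 1, Tendsto (fun M : ℕ => (DD θ s M : ℝ) / M) g (nhds y) := by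
    intro s
    have := isCompact_iff_ultrafilter_le_nhds.1 (isCompact_Icc (a := (0:ℝ)) (b := 1))
      (g.map (fun M : ℕ => (DD θ s M : ℝ) / M)) (by
        rw [le_principal_iff]
        rw [Ultrafilter.coe_map, mem_map]
        refine Filter.mem_of_superset univ_mem fun M _ => ⟨by positivity, ?_⟩
        apply div_le_one_of_le₀ _ (by positivity)
        exact_mod_cast DD_le θ s M)
    exact this
  choose f hf hlim using hex
  have hmono : ∀ s t, s ≤ t → f s ≤ f t := fun s t h =>
    le_of_tendsto_of_tendsto' (hlim s) (hlim t) fun M => by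
      have := DD_mono θ h M
      gcongr
  have hone : f 1 = 1 := by
    refine tendsto_nhds_unique (hlim 1) ?_
    refine (tendsto_const_nhds (x := (1:ℝ))).congr' ?_
    filter_upwards [hg (eventually_gt_atTop 0)] with M hM
    rw [DD_one, div_self]; positivity
  have hadd : ∀ (m : ℕ) (u : ℝ), 0 ≤ u → Int.fract (m * θ) + u ≤ 1 →
      f (Int.fract (m * θ) + u) = f (Int.fract (m * θ)) + f u := by
    intro m u hu hu1
    have hz : Tendsto (fun M : ℕ => (m : ℝ) / M) g (nhds 0) :=
      (tendsto_const_div_atTop_nhds_zero_nat (m:ℝ)).mono_left hg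
    apply le_antisymm
    · have h2 := ((hlim (Int.fract (m * θ))).add (hlim u)).add hz
      rw [add_zero] at h2
      refine le_of_tendsto_of_tendsto' (hlim _) h2 fun M => ?_
      have := (DD_add θ m hu hu1 M).1
      rw [← add_div, ← add_div]
      gcongr
      exact_mod_cast this
    · have h2 := (hlim (Int.fract (m * θ) + u)).add hz
      rw [add_zero] at h2
      refine le_of_tendsto_of_tendsto' ((hlim (Int.fract (m * θ))).add (hlim u)) h2 fun M => ?_
      have := (DD_add θ m hu hu1 M).2
      rw [← add_div, ← add_div]
      refine div_le_div_of_nonneg_right ?_ (by positivity)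
      exact_mod_cast this
  suffices h : f t = t by have h2 := hlim t; rwa [h] at h2
  apply squeeze_lim _ (hf t).1 (hf t).2
  intro ε hε hε1
  obtain ⟨m, hm, hd0, hdε⟩ := fract_dense hθ le_rfl hε hε1.le
  refine ⟨_, hd0, hdε, ?_⟩
  have hadd := hadd m
  set δ := Int.fract (m * θ) with hδ
  have h00 : f 0 = 0 := by
    have := hadd 0 le_rfl (by linarith)
    simp at this; exact this
  have hmul : ∀ (i : ℕ), ∀ u, 0 ≤ u → i * δ + u ≤ 1 → f (i * δ + u) = i * f δ + f u := by
    intro i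
    induction i with
    | zero => intro u _ _; simp
    | succ i ih =>
      intro u hu hu1
      push_cast at hu1 ⊢
      have h1 := ih (δ + u) (by linarith) (by linarith)
      have h2 : 0 ≤ i * δ := by positivity
      have h3 := hadd u hu (by linarith)
      rw [show ((i:ℝ) + 1) * δ + u = i * δ + (δ + u) by ring, h1, h3]; ring
  have hfl : ∀ s : ℝ, 0 ≤ s → s ≤ 1 → ∃ i : ℕ, i * δ ≤ s ∧ s ≤ (i + 1) * δ ∧ i * f δ ≤ f s ∧
      f s ≤ (i + 1) * f δ := by
    intro s hs hs1
    have e1 : ⌊s / δ⌋₊ * δ ≤ s := (le_div_iff₀ hd0).1 (Nat.floor_le (by positivity))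
    have e2 : s ≤ (⌊s / δ⌋₊ + 1) * δ := ((div_lt_iff₀ hd0).1 (Nat.lt_floor_add_one _)).le
    refine ⟨⌊s / δ⌋₊, e1, e2, ?_⟩
    have := hmul ⌊s / δ⌋₊ (s - ⌊s / δ⌋₊ * δ) (by linarith) (by linarith)
    rw [show ⌊s / δ⌋₊ * δ + (s - ⌊s / δ⌋₊ * δ) = s by ring] at this
    have h1 := (hf (s - ⌊s / δ⌋₊ * δ)).1
    have h2 := hmono (s - ⌊s / δ⌋₊ * δ) δ (by linarith)
    constructor <;> linarith
  obtain ⟨q, q1, q2, q3, q4⟩ := hfl 1 zero_le_one le_rfl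
  obtain ⟨i, i1, i2, i3, i4⟩ := hfl t ht ht1
  rw [hone] at q3 q4
  have hF := (hf δ).1
  have hi : (0:ℝ) ≤ i := by positivity
  have hq : (0:ℝ) ≤ q := by positivity
  constructor
  · calc f t * (1 - δ) ≤ ((i + 1) * f δ) * (q * δ) := by
          apply mul_le_mul i4 (by linarith) (by linarith) (by positivity)
      _ = (q * f δ) * ((i + 1) * δ) := by ring
      _ ≤ 1 * ((i + 1) * δ) := by gcongr
      _ ≤ t + δ := by linarith
  · calc t - δ ≤ (i * δ) * 1 := by linarith
      _ ≤ (i * δ) * ((q + 1) * f δ) := by gcongr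
      _ = (i * f δ) * (q * δ + δ) := by ring
      _ ≤ f t * (1 + δ) := by
        apply mul_le_mul i3 (by linarith) (by positivity) (hf t).1

lemma cover {θ : ℝ} (hθ : Irrational θ) (k l : ℕ) (hk : 2 ≤ k) (ε : ℝ) (hε : 0 < ε) :
    ∃ N0 : ℕ, ∀ x : ℝ, ε ≤ x → x ≤ ((l + 1 : ℕ) : ℝ) / k - ε →
      ∃ n : ℕ, 0 < n ∧ l * n < N0 ∧ Int.fract (n * θ) < 1 / k ∧
        l * Int.fract (n * θ) ≤ x ∧ x < l * Int.fract (n * θ) + 1 / k := by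
  have hk0 : (0:ℝ) < k := by positivity
  have hk1 : (1:ℝ) / k ≤ 1 := by
    rw [div_le_one hk0]; exact_mod_cast (by omega : 1 ≤ k)
  let U : {n : ℕ // 0 < n ∧ Int.fract (n * θ) < 1 / (k:ℝ)} → Set ℝ :=
    fun n => Set.Ioo (l * Int.fract ((n:ℕ) * θ)) (l * Int.fract ((n:ℕ) * θ) + 1 / k)
  obtain ⟨T, hT⟩ := (isCompact_Icc (a := ε) (b := ((l + 1 : ℕ) : ℝ) / k - ε)).elim_finite_subcover U
    (fun _ => isOpen_Ioo) (by
      rintro x ⟨hx1, hx2⟩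
      have hl : (0:ℝ) < l + 1 := by positivity
      have hx0 : 0 < x := by linarith
      have hxk : x / (l + 1) < 1 / k := by
        rw [div_lt_div_iff₀ hl hk0]
        have : x < ((l + 1 : ℕ) : ℝ) / k := by linarith
        rw [lt_div_iff₀ hk0] at this
        push_cast at this; linarith
      set η := (1 / k - x / (l + 1)) / (l + 1) with hη
      have hη0 : 0 < η := div_pos (by linarith) hl
      have hη1 : (l + 1) * η = 1 / k - x / (l + 1) := by rw [hη]; field_simp
      have hxl : (l + 1) * (x / (l + 1)) = x := by field_simp
      have hxp : 0 < x / (l + 1) := by positivity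
      obtain ⟨n, hn, h1, h2⟩ := fract_dense hθ (le_max_left 0 (x / (l + 1) - η))
        (max_lt hxp (by linarith : x / (l + 1) - η < x / (l + 1))) (by linarith)
      have h3 := (le_max_right _ _).trans_lt h1
      rw [Set.mem_iUnion]
      refine ⟨⟨n, hn, h2.trans hxk⟩, ?_, ?_⟩
      · have : (l:ℝ) * Int.fract (n * θ) ≤ l * (x / (l + 1)) := by gcongr
        show (l:ℝ) * Int.fract (n * θ) < x
        linarith
      · have : (l:ℝ) * (x / (l + 1) - η) ≤ l * Int.fract (n * θ) := by gcongr
        show x < (l:ℝ) * Int.fract (n * θ) + 1 / k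
        linarith)
  refine ⟨T.sup (fun n => l * (n:ℕ)) + 1, fun x h1 h2 => ?_⟩
  have := hT ⟨h1, h2⟩
  simp only [Set.mem_iUnion] at this
  obtain ⟨n, hn, hx⟩ := this
  refine ⟨n, n.2.1, ?_, n.2.2, hx.1.le, hx.2⟩
  have := Finset.le_sup (f := fun n : {n : ℕ // 0 < n ∧ Int.fract (n * θ) < 1 / (k:ℝ)} => l * (n:ℕ)) hn
  omega

section main
variable {α θ : ℝ} {k : ℕ} {A : Set ℕ}

lemma toNat_floor_cast {x : ℝ} (hx : 0 ≤ x) : ((⌊x⌋.toNat : ℕ) : ℝ) = x - Int.fract x := by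
  have h : ((⌊x⌋.toNat : ℕ) : ℤ) = ⌊x⌋ := Int.toNat_of_nonneg (Int.floor_nonneg.2 hx)
  have h2 : ((⌊x⌋.toNat : ℕ) : ℝ) = ((⌊x⌋ : ℤ) : ℝ) := by exact_mod_cast h
  rw [h2]; linarith [Int.floor_add_fract x]

lemma upper (hθ0 : 0 < θ) (hk : 2 ≤ k)
    (hA : A = (fun n : ℕ => (⌊(n : ℝ) * θ⌋).toNat) ''
      {n : ℕ | 0 < n ∧ Int.fract ((n : ℝ) * θ) < 1 / (k : ℝ)}) {j : ℕ} (hj : 1 ≤ j) (hjk : j ≤ k)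
    {x : ℕ} (hx : x ∈ foldSum j A) :
    ∃ N : ℕ, Int.fract (N * θ) < j / k ∧ (⌊(N : ℝ) * θ⌋).toNat = x := by
  have hk0 : (0:ℝ) < k := by positivity
  obtain ⟨f, hf, rfl⟩ := hx
  simp only [hA, Set.mem_image, Set.mem_ofPred_eq] at hf
  choose g hg hgf using hf
  have hc : ∀ i, (f i : ℝ) = g i * θ - Int.fract (g i * θ) := fun i => by
    rw [← hgf i]; exact toNat_floor_cast (by positivity)
  have hlt : ∑ i, Int.fract (g i * θ) < j / k := by
    have : Nonempty (Fin j) := ⟨⟨0, hj⟩⟩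
    calc ∑ i, Int.fract (g i * θ) < ∑ i : Fin j, 1 / (k:ℝ) :=
          Finset.sum_lt_sum_of_nonempty Finset.univ_nonempty fun i _ => (hg i).2
      _ = j / k := by simp [div_eq_mul_inv]
  have hj1 : (j:ℝ) / k ≤ 1 := by rw [div_le_one hk0]; exact_mod_cast hjk
  have hs : ((∑ i, f i : ℕ) : ℝ) = (∑ i, g i : ℕ) * θ - ∑ i, Int.fract (g i * θ) := by
    push_cast
    rw [Finset.sum_congr rfl fun i _ => hc i, Finset.sum_sub_distrib, Finset.sum_mul]
  have hfr : Int.fract (((∑ i, g i : ℕ):ℝ) * θ) = ∑ i, Int.fract (g i * θ) := by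
    rw [Int.fract_eq_iff]
    refine ⟨Finset.sum_nonneg fun i _ => Int.fract_nonneg _, by linarith, ((∑ i, f i : ℕ) : ℤ), ?_⟩
    rw [Int.cast_natCast, hs]
  refine ⟨∑ i, g i, hfr ▸ hlt, ?_⟩
  have := toNat_floor_cast (x := ((∑ i, g i : ℕ):ℝ) * θ) (by positivity)
  rw [hfr, ← hs] at this
  exact_mod_cast this

lemma lower (hirr : Irrational θ) (hθ0 : 0 < θ) (hk : 2 ≤ k)
    (hA : A = (fun n : ℕ => (⌊(n : ℝ) * θ⌋).toNat) ''
      {n : ℕ | 0 < n ∧ Int.fract ((n : ℝ) * θ) < 1 / (k : ℝ)}) {j : ℕ} (hj : 1 ≤ j)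
    (ε : ℝ) (hε : 0 < ε) :
    ∃ N0 : ℕ, ∀ N : ℕ, N0 ≤ N → ε ≤ Int.fract (N * θ) → Int.fract (N * θ) < j / k - ε →
      (⌊(N : ℝ) * θ⌋).toNat ∈ foldSum j A := by
  have hk0 : (0:ℝ) < k := by positivity
  have hk1 : (1:ℝ) / k ≤ 1 := by
    rw [div_le_one hk0]; exact_mod_cast (by omega : 1 ≤ k)
  obtain ⟨l, rfl⟩ := Nat.exists_eq_add_of_le' hj
  obtain ⟨N0, hN0⟩ := cover hirr k l hk ε hε
  refine ⟨N0, fun N hN h1 h2 => ?_⟩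
  obtain ⟨n, hn, hln, hfn, hx1, hx2⟩ := hN0 _ h1 h2.le
  obtain ⟨p, rfl⟩ := Nat.exists_eq_add_of_lt (hln.trans_le hN)
  set N := l * n + p + 1 with hNd
  have hcast : (N:ℝ) = l * n + ((p + 1 : ℕ) : ℝ) := by rw [hNd]; push_cast; ring
  have hfr : Int.fract (((p + 1 : ℕ):ℝ) * θ) = Int.fract (N * θ) - l * Int.fract (n * θ) := by
    rw [Int.fract_eq_iff]
    refine ⟨by linarith, by linarith, ⌊(N:ℝ) * θ⌋ - l * ⌊(n:ℝ) * θ⌋, ?_⟩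
    push_cast
    have e1 := Int.floor_add_fract ((N:ℝ) * θ)
    have e2 : (l:ℝ) * (⌊(n:ℝ) * θ⌋ + Int.fract (n * θ)) = l * (n * θ) := by
      rw [Int.floor_add_fract ((n:ℝ) * θ)]
    have e3 : (N:ℝ) * θ = l * (n * θ) + (p + 1) * θ := by rw [hcast]; push_cast; ring
    linarith
  refine ⟨Fin.cons (⌊((p + 1 : ℕ):ℝ) * θ⌋).toNat (fun _ => (⌊(n:ℝ) * θ⌋).toNat), ?_, ?_⟩
  · intro i
    rw [hA]
    refine Fin.cases ?_ (fun i => ?_) i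
    · exact ⟨p + 1, ⟨by omega, by rw [hfr]; linarith⟩, rfl⟩
    · exact ⟨n, ⟨hn, hfn⟩, rfl⟩
  · rw [Fin.sum_univ_succ]
    simp only [Fin.cons_zero, Fin.cons_succ, Finset.sum_const, Finset.card_univ, Fintype.card_fin,
      smul_eq_mul]
    have : (((⌊(N:ℝ) * θ⌋).toNat : ℕ) : ℝ) =
        (((⌊((p + 1 : ℕ):ℝ) * θ⌋).toNat + l * (⌊(n:ℝ) * θ⌋).toNat : ℕ) : ℝ) := by
      rw [Nat.cast_add (⌊((p + 1 : ℕ):ℝ) * θ⌋).toNat, Nat.cast_mul l,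
        toNat_floor_cast (x := (N:ℝ) * θ) (by positivity),
        toNat_floor_cast (x := ((p + 1 : ℕ):ℝ) * θ) (by positivity),
        toNat_floor_cast (x := (n:ℝ) * θ) (by positivity), hfr]
      have e3 : (N:ℝ) * θ = l * (n * θ) + ((p + 1 : ℕ):ℝ) * θ := by rw [hcast]; ring
      linarith
    exact_mod_cast this

lemma lt_ceil_iff (h0 : 0 < α) (hθ : θ = 1 / α) (N n : ℕ) :
    N < ⌈((n:ℝ) + 1) * α⌉₊ ↔ (⌊(N:ℝ) * θ⌋).toNat ≤ n := by
  rw [Nat.lt_ceil, hθ, mul_one_div, ← div_lt_iff₀ h0, Int.toNat_le, ← Int.lt_add_one_iff,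
    Int.floor_lt]
  push_cast
  rfl

lemma count_upper (h0 : 0 < α) (hθ : θ = 1 / α) {X : Set ℕ} {c : ℝ}
    (h : ∀ x ∈ X, ∃ N : ℕ, Int.fract (N * θ) < c ∧ (⌊(N : ℝ) * θ⌋).toNat = x) (n : ℕ) :
    countUpTo X n ≤ DD θ c ⌈((n:ℝ) + 1) * α⌉₊ := by
  classical
  unfold countUpTo DD
  refine le_trans ?_ (Finset.card_image_le (f := fun N : ℕ => (⌊(N : ℝ) * θ⌋).toNat))
  rw [← Set.ncard_coe_finset]
  refine Set.ncard_le_ncard ?_ (Finset.finite_toSet _)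
  rintro x ⟨hx, hx1, hx2⟩
  obtain ⟨N, hN, rfl⟩ := h x hx
  simp only [Finset.coe_image, Set.mem_image, Finset.mem_coe, Finset.mem_filter, Finset.mem_range]
  exact ⟨N, ⟨(lt_ceil_iff h0 hθ N n).2 hx2, hN⟩, rfl⟩

lemma floor_inj (hθ1 : 1 < θ) : Function.Injective (fun N : ℕ => (⌊(N : ℝ) * θ⌋).toNat) := by
  apply StrictMono.injective
  apply strictMono_nat_of_lt_succ
  intro n
  have h1 := toNat_floor_cast (x := (n:ℝ) * θ) (by positivity)
  have h2 := toNat_floor_cast (x := ((n + 1 : ℕ):ℝ) * θ) (by positivity)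
  have h3 := Int.fract_nonneg ((n:ℝ) * θ)
  have h4 := Int.fract_lt_one (((n + 1 : ℕ):ℝ) * θ)
  have h5 : ((n + 1 : ℕ):ℝ) * θ = n * θ + θ := by push_cast; ring
  have : (((⌊(n:ℝ) * θ⌋).toNat : ℕ) : ℝ) < (⌊((n + 1 : ℕ):ℝ) * θ⌋.toNat : ℕ) := by
    linarith
  exact_mod_cast this

lemma count_lower (h0 : 0 < α) (hθ : θ = 1 / α) (hθ1 : 1 < θ) {X : Set ℕ} {a b : ℝ} (hab : a ≤ b)
    {N0 : ℕ}
    (h : ∀ N : ℕ, N0 ≤ N → a ≤ Int.fract (N * θ) → Int.fract (N * θ) < b →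
      (⌊(N : ℝ) * θ⌋).toNat ∈ X) (n : ℕ) :
    DD θ b ⌈((n:ℝ) + 1) * α⌉₊ ≤ countUpTo X n + DD θ a ⌈((n:ℝ) + 1) * α⌉₊ + (N0 + 1) := by
  classical
  rw [DD_sub θ hab]
  suffices hs : ((Finset.range ⌈((n:ℝ) + 1) * α⌉₊).filter
      (fun n : ℕ => a ≤ Int.fract (n * θ) ∧ Int.fract (n * θ) < b)).card ≤
      countUpTo X n + (N0 + 1) by omega
  set S := (Finset.range ⌈((n:ℝ) + 1) * α⌉₊).filter
      (fun n : ℕ => a ≤ Int.fract (n * θ) ∧ Int.fract (n * θ) < b) with hS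
  have h1 : S ⊆ S.filter (fun N => N0 + 1 ≤ N) ∪ Finset.range (N0 + 1) := by
    intro N hN
    simp only [Finset.mem_union, Finset.mem_filter, Finset.mem_range]
    by_cases hc : N0 + 1 ≤ N
    · exact Or.inl ⟨hN, hc⟩
    · right; omega
  refine (Finset.card_le_card h1).trans ((Finset.card_union_le _ _).trans ?_)
  rw [Finset.card_range]
  apply Nat.add_le_add_right
  unfold countUpTo
  rw [← Finset.card_image_of_injective _ (floor_inj hθ1), ← Set.ncard_coe_finset]
  refine Set.ncard_le_ncard ?_ ((Set.finite_Icc 1 n).subset Set.inter_subset_right)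
  intro x hx
  simp only [Finset.coe_image, Set.mem_image, Finset.mem_coe, Finset.mem_filter, hS,
    Finset.mem_range] at hx
  obtain ⟨N, ⟨⟨hN1, hN2, hN3⟩, hN4⟩, rfl⟩ := hx
  refine ⟨h N (by omega) hN2 hN3, ?_, (lt_ceil_iff h0 hθ N n).1 hN1⟩
  have := (floor_inj hθ1).ne (show N ≠ 0 by omega)
  simp only [Nat.cast_zero, zero_mul, Int.floor_zero, Int.toNat_zero] at this
  omega

lemma dens_M (hirr : Irrational θ) (h0 : 0 < α) {t : ℝ} (ht : 0 ≤ t) (ht1 : t ≤ 1) :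
    Tendsto (fun n : ℕ => (DD θ t ⌈((n:ℝ) + 1) * α⌉₊ : ℝ) / n) atTop (nhds (t * α)) := by
  have hinf : Tendsto (fun n : ℕ => ⌈((n:ℝ) + 1) * α⌉₊) atTop atTop := by
    refine tendsto_nat_ceil_atTop.comp ?_
    exact (tendsto_natCast_atTop_atTop.atTop_add tendsto_const_nhds).atTop_mul_const h0
  have hr : Tendsto (fun n : ℕ => (⌈((n:ℝ) + 1) * α⌉₊ : ℝ) / n) atTop (nhds α) := by
    have hu : Tendsto (fun n : ℕ => α + (α + 1) / (n:ℝ)) atTop (nhds α) := by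
      simpa using (tendsto_const_nhds (x := α)).add (tendsto_const_div_atTop_nhds_zero_nat (α + 1))
    refine tendsto_of_tendsto_of_tendsto_of_le_of_le' tendsto_const_nhds hu ?_ ?_
    · filter_upwards [eventually_gt_atTop 0] with n hn
      have hn' : (0:ℝ) < n := by exact_mod_cast hn
      rw [le_div_iff₀ hn']
      have := Nat.le_ceil (((n:ℝ) + 1) * α)
      linarith
    · filter_upwards [eventually_gt_atTop 0] with n hn
      have hn' : (0:ℝ) < n := by exact_mod_cast hn
      rw [div_le_iff₀ hn', add_mul α, div_mul_cancel₀ _ hn'.ne']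
      have := Nat.ceil_lt_add_one (show 0 ≤ ((n:ℝ) + 1) * α by positivity)
      linarith
  refine (((dens hirr ht ht1).comp hinf).mul hr).congr' ?_
  filter_upwards [hinf.eventually_gt_atTop 0] with n hn
  have hn' : (0:ℝ) < ⌈((n:ℝ) + 1) * α⌉₊ := by exact_mod_cast hn
  simp only [Function.comp]
  rw [div_mul_div_cancel₀ hn'.ne']

end main

theorem stmt10 (α : ℝ) (hirr : Irrational α) (h0 : 0 < α) (h1 : α < 1)
    (θ : ℝ) (hθ : θ = 1 / α) (k : ℕ) (hk : 2 ≤ k) (A : Set ℕ)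
    (hA : A = (fun n : ℕ => (⌊(n : ℝ) * θ⌋).toNat) ''
      {n : ℕ | 0 < n ∧ Int.fract ((n : ℝ) * θ) < 1 / (k : ℝ)}) :
    ∀ j : ℕ, 1 ≤ j → j ≤ k →
      HasDensity (foldSum j A) ((j : ℝ) * α / k) := by
  intro j hj hjk
  have hk0 : (0:ℝ) < k := by positivity
  have hθi : Irrational θ := by rw [hθ, one_div]; exact hirr.inv
  have hθ1 : 1 < θ := by rw [hθ]; exact one_lt_one_div h0 h1
  have hc0 : (0:ℝ) < j / k := by positivity
  have hc1 : (j:ℝ) / k ≤ 1 := by rw [div_le_one hk0]; exact_mod_cast hjk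
  rw [show (j:ℝ) * α / k = j / k * α by ring]
  set c : ℝ := j / k with hc
  unfold HasDensity
  rw [tendsto_order]
  constructor
  · intro a ha
    obtain ⟨ε, hε, hε1, hε2⟩ : ∃ ε, 0 < ε ∧ ε ≤ c / 2 ∧ a < (c - ε) * α - ε * α := by
      refine ⟨min (c / 2) ((c * α - a) / (4 * α)), ?_, min_le_left _ _, ?_⟩
      · refine lt_min (by linarith) (div_pos (by linarith) (by linarith))
      · have h2 := min_le_right (c / 2) ((c * α - a) / (4 * α))
        rw [le_div_iff₀ (by linarith)] at h2
        linarith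
    obtain ⟨N0, hN0⟩ := lower hθi (by linarith) hk hA hj ε hε
    have hL := count_lower h0 hθ hθ1 (by linarith : ε ≤ c - ε) hN0
    have ht := ((dens_M hθi h0 (by linarith : 0 ≤ c - ε) (by linarith)).sub
      (dens_M hθi h0 hε.le (by linarith))).sub
        (tendsto_const_div_atTop_nhds_zero_nat ((N0:ℝ) + 1))
    rw [sub_zero] at ht
    filter_upwards [ht.eventually_const_lt hε2] with n hn
    refine hn.trans_le ?_
    rw [← sub_div, ← sub_div]
    refine div_le_div_of_nonneg_right ?_ (by positivity)
    have : (DD θ (c - ε) ⌈((n:ℝ) + 1) * α⌉₊ : ℝ) ≤ countUpTo (foldSum j A) n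
      + DD θ ε ⌈((n:ℝ) + 1) * α⌉₊ + (N0 + 1) := by exact_mod_cast hL n
    linarith
  · intro a ha
    have hU := count_upper h0 hθ (c := c) (X := foldSum j A)
      (fun x hx => upper (by linarith) hk hA hj hjk hx)
    filter_upwards [(dens_M hθi h0 hc0.le hc1).eventually_lt_const ha] with n hn
    refine lt_of_le_of_lt ?_ hn
    refine div_le_div_of_nonneg_right ?_ (by positivity)
    exact_mod_cast hU n
end
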